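/- Let G be 3-edge-connected with DFS tree T rooted at r, and let u, v be vertices distinct from r with v < u. If {(u,p(u)), (v,p(v)), e} is a 3-cut of G, where e is a back-edge, then v is an ancestor of u and either B(v) = B(u) ⊔ {e} or B(u) = B(v) ⊔ {e} (disjoint union). -/

import Mathlib

/-- An undirected multigraph `G` (parallel edges allowed, no self-loops) together with a
DFS spanning tree `T` rooted at `root`, where the vertices are identified with their DFS
preorder numbers (so they are `Fin n`, and the root gets the smallest number).
Tree edges are oriented from child to parent and back-edges from descendant to
(proper) ancestor. -/
structure DFSGraph where
  /-- number of vertices; the vertices are `Fin n`, numbered in DFS preorder -/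
  n : ℕ
  /-- the type indexing the edges (parallel edges are allowed) -/
  Edge : Type
  edgeFintype : Fintype Edge
  /-- the first endpoint (the descendant end) of each edge -/
  fst : Edge → Fin n
  /-- the second endpoint (the ancestor end) of each edge -/
  snd : Edge → Fin n
  /-- no self-loops -/
  noloop : ∀ e, fst e ≠ snd e
  /-- the root `r` of the DFS tree -/
  root : Fin n
  /-- in DFS preorder the root gets the smallest number -/
  root_le : ∀ v, root ≤ v
  /-- the parent function `p` of the DFS tree (arbitrary at the root) -/
  parent : Fin n → Fin n
  /-- the parent of a non-root vertex precedes it in preorder -/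
  parent_lt : ∀ v, v ≠ root → parent v < v
  /-- `tEdge v` is the tree edge `(v, p(v))`, for `v ≠ root` -/
  tEdge : Fin n → Edge
  tEdge_fst : ∀ v, v ≠ root → fst (tEdge v) = v
  tEdge_snd : ∀ v, v ≠ root → snd (tEdge v) = parent v
  tEdge_inj : ∀ u v, u ≠ root → v ≠ root → tEdge u = tEdge v → u = v
  /-- DFS property: every non-tree edge is a back-edge, i.e. it joins a vertex to an
  ancestor of it (a proper ancestor, by `noloop`) -/
  back_anc : ∀ e, (¬ ∃ v, v ≠ root ∧ e = tEdge v) →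
    Relation.ReflTransGen (fun x y => x ≠ root ∧ y = parent x) (fst e) (snd e)
  /-- preorder property: the descendants of any vertex form an interval of preorder
  numbers starting at that vertex -/
  preorder_interval : ∀ v u w : Fin n, v ≤ u → u ≤ w →
    Relation.ReflTransGen (fun x y => x ≠ root ∧ y = parent x) w v →
    Relation.ReflTransGen (fun x y => x ≠ root ∧ y = parent x) u v

namespace DFSGraph

variable (G : DFSGraph)

/-- `Anc a b`: `a` is an ancestor of `b` in `T` (every vertex is an ancestor of itself). -/
def Anc (a b : Fin G.n) : Prop :=
  Relation.ReflTransGen (fun x y => x ≠ G.root ∧ y = G.parent x) b a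

/-- `PAnc a b`: `a` is a proper ancestor of `b` in `T`. -/
def PAnc (a b : Fin G.n) : Prop := G.Anc a b ∧ a ≠ b

/-- `e` is an edge of the spanning tree `T`. -/
def IsTreeEdge (e : G.Edge) : Prop := ∃ v, v ≠ G.root ∧ e = G.tEdge v

/-- `e` is a back-edge (an edge of `G ∖ T`). -/
def IsBack (e : G.Edge) : Prop := ¬ G.IsTreeEdge e

/-- `B v`: the set of back-edges `(x, y)` with `x` a descendant of `v` and `y` a proper
ancestor of `v`. -/
def B (v : Fin G.n) : Set G.Edge :=
  {e | G.IsBack e ∧ G.Anc v (G.fst e) ∧ G.PAnc (G.snd e) v}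

/-- `b_count(v) = |B(v)|`. -/
noncomputable def bcount (v : Fin G.n) : ℕ := (G.B v).ncard

/-- adjacency in `G` after removing the edge set `S` -/
def AdjOff (S : Set G.Edge) (x y : Fin G.n) : Prop :=
  ∃ e, e ∉ S ∧ ((G.fst e = x ∧ G.snd e = y) ∨ (G.fst e = y ∧ G.snd e = x))

/-- `G ∖ S` is connected -/
def ConnectedOff (S : Set G.Edge) : Prop :=
  ∀ x y, Relation.ReflTransGen (G.AdjOff S) x y

/-- `S` is an edge cut of `G`: removing `S` disconnects `G`. -/
def IsCut (S : Set G.Edge) : Prop := ¬ G.ConnectedOff S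

/-- `G` is `k`-edge-connected: it has no cut of fewer than `k` edges. -/
def EdgeConn (k : ℕ) : Prop := ∀ S : Set G.Edge, S.ncard < k → ¬ G.IsCut S

/-- `IsLow1 v y`: `y = low1(v) = min {y | ∃ (x,y) ∈ B(v)}`. -/
def IsLow1 (v y : Fin G.n) : Prop :=
  (∃ e ∈ G.B v, G.snd e = y) ∧ ∀ e ∈ G.B v, y ≤ G.snd e

/-- `IsHigh v y`: `y = high(v) = max {y | ∃ (x,y) ∈ B(v)}`. -/
def IsHigh (v y : Fin G.n) : Prop :=
  (∃ e ∈ G.B v, G.snd e = y) ∧ ∀ e ∈ G.B v, G.snd e ≤ y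

/-- `IsLow2 v y`: `y = low2(v)`, the minimum lower end of the back-edges in `B(v)` minus
one (fixed, but arbitrary) back-edge `(low1D(v), low1(v))` attaining `low1(v)`. -/
def IsLow2 (v y : Fin G.n) : Prop :=
  ∃ f ∈ G.B v, (∀ g ∈ G.B v, G.snd f ≤ G.snd g) ∧
    (∃ e ∈ G.B v, e ≠ f ∧ G.snd e = y) ∧
    (∀ e ∈ G.B v, e ≠ f → y ≤ G.snd e)

/-- `IsL1 v y`: `y = l1(v) = min ({y | (v,y) is a back-edge} ∪ {v})`. -/
def IsL1 (v y : Fin G.n) : Prop :=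
  (y = v ∨ ∃ e, G.IsBack e ∧ G.fst e = v ∧ G.snd e = y) ∧
  y ≤ v ∧ (∀ e, G.IsBack e → G.fst e = v → y ≤ G.snd e)

/-- `IsL2 v y`: `y = l2(v)`, defined as `l1(v)` but after removing one (fixed, but
arbitrary) back-edge `(v, l1(v))` attaining `l1(v)`, if such a back-edge exists. -/
def IsL2 (v y : Fin G.n) : Prop :=
  ((¬ ∃ e, G.IsBack e ∧ G.fst e = v) ∧ y = v) ∨
  (∃ f, G.IsBack f ∧ G.fst f = v ∧
    (∀ g, G.IsBack g → G.fst g = v → G.snd f ≤ G.snd g) ∧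
    (y = v ∨ ∃ e, G.IsBack e ∧ G.fst e = v ∧ e ≠ f ∧ G.snd e = y) ∧
    y ≤ v ∧
    (∀ e, G.IsBack e → G.fst e = v → e ≠ f → y ≤ G.snd e))

/-- `z` is the nearest common ancestor of the set of vertices `S`. -/
def IsNCA (S : Set (Fin G.n)) (z : Fin G.n) : Prop :=
  (∀ x ∈ S, G.Anc z x) ∧ ∀ z', (∀ x ∈ S, G.Anc z' x) → G.Anc z' z

/-- `IsM v m`: `m = M(v)`, the nearest common ancestor of all higher ends of back-edges
in `B(v)`. -/
def IsM (v m : Fin G.n) : Prop :=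
  G.IsNCA {x | ∃ e ∈ G.B v, G.fst e = x} m

/-- `IsMtilde v m`: `m = M̃(v)`, the nearest common ancestor of all higher ends of
back-edges in `B(v)` that are proper descendants of `M(v)` (defined only if such a
higher end exists). -/
def IsMtilde (v m : Fin G.n) : Prop :=
  ∃ mv, G.IsM v mv ∧
    {x | ∃ e ∈ G.B v, G.fst e = x ∧ G.PAnc mv x}.Nonempty ∧
    G.IsNCA {x | ∃ e ∈ G.B v, G.fst e = x ∧ G.PAnc mv x} m

/-- `c` is a child of `p` in `T`. -/
def IsChild (p c : Fin G.n) : Prop := c ≠ G.root ∧ G.parent c = p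

/-- `low1(c) ≤ low1(c')` (stated relationally). -/
def Low1LE (c c' : Fin G.n) : Prop :=
  ∀ y y', G.IsLow1 c y → G.IsLow1 c' y' → y ≤ y'

/-- `c = c₁(p)`: `c` is a `low1` child of `p`, i.e. a child of `p` minimizing `low1`. -/
def IsC1 (p c : Fin G.n) : Prop :=
  G.IsChild p c ∧ ∀ c', G.IsChild p c' → G.Low1LE c c'

/-- `c = c₂(p)`: `c` is a `low2` child of `p`, i.e. a child of `p` minimizing `low1`
among the children different from the (fixed) `low1` child. -/
def IsC2 (p c : Fin G.n) : Prop :=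
  ∃ c1, G.IsC1 p c1 ∧ G.IsChild p c ∧ c ≠ c1 ∧
    ∀ c', G.IsChild p c' → c' ≠ c1 → G.Low1LE c c'

/-- `c = c₃(p)`: `c` is a `low3` child of `p`. -/
def IsC3 (p c : Fin G.n) : Prop :=
  ∃ c1 c2, G.IsC1 p c1 ∧
    (G.IsChild p c2 ∧ c2 ≠ c1 ∧ ∀ c', G.IsChild p c' → c' ≠ c1 → G.Low1LE c2 c') ∧
    G.IsChild p c ∧ c ≠ c1 ∧ c ≠ c2 ∧
    (∀ c', G.IsChild p c' → c' ≠ c1 → c' ≠ c2 → G.Low1LE c c')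

/-- `IsMlow1 v m`: `m = M_low1(v)`, the nearest common ancestor of all higher ends of
back-edges in `B(v)` that are descendants of the `low1` child of `M(v)` (defined only
if such a higher end exists). -/
def IsMlow1 (v m : Fin G.n) : Prop :=
  ∃ mv c1, G.IsM v mv ∧ G.IsC1 mv c1 ∧
    {x | ∃ e ∈ G.B v, G.fst e = x ∧ G.Anc c1 x}.Nonempty ∧
    G.IsNCA {x | ∃ e ∈ G.B v, G.fst e = x ∧ G.Anc c1 x} m

/-- `IsMlow2 v m`: `m = M_low2(v)`, the nearest common ancestor of all higher ends of
back-edges in `B(v)` that are descendants of the `low2` child of `M(v)` (defined only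
if such a higher end exists). -/
def IsMlow2 (v m : Fin G.n) : Prop :=
  ∃ mv c2, G.IsM v mv ∧ G.IsC2 mv c2 ∧
    {x | ∃ e ∈ G.B v, G.fst e = x ∧ G.Anc c2 x}.Nonempty ∧
    G.IsNCA {x | ∃ e ∈ G.B v, G.fst e = x ∧ G.Anc c2 x} m

/-- `IsNextM v w`: `w = nextM(v)`, the maximum vertex `w < v` with `M(w) = M(v)`. -/
def IsNextM (v w : Fin G.n) : Prop :=
  ∃ m, G.IsM v m ∧ G.IsM w m ∧ w < v ∧ ∀ w', w' < v → G.IsM w' m → w' ≤ w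

/-- `IsLowM v l`: `l = low_M(v) = min {y | ∃ (x,y) ∈ B(v) ∖ B(nextM(v))}`. -/
def IsLowM (v l : Fin G.n) : Prop :=
  ∃ w, G.IsNextM v w ∧ (∃ e ∈ G.B v, e ∉ G.B w ∧ G.snd e = l) ∧
    ∀ e ∈ G.B v, e ∉ G.B w → l ≤ G.snd e

end DFSGraph

namespace DFSGraph

variable {G : DFSGraph}

theorem Anc.le {a b : Fin G.n} (h : G.Anc a b) : a ≤ b := by
  induction h with
  | refl => exact le_rfl
  | tail _ hbc ih =>
    obtain ⟨hne, rfl⟩ := hbc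
    exact (G.parent_lt _ hne).le.trans ih

/-- Two ancestors of a common vertex are comparable. -/
theorem Anc.of_le {a b c : Fin G.n} (ha : G.Anc a c) (hb : G.Anc b c) (hab : a ≤ b) :
    G.Anc a b :=
  G.preorder_interval a b c hab hb.le ha

theorem Anc.trans {a b c : Fin G.n} (hab : G.Anc a b) (hbc : G.Anc b c) : G.Anc a c :=
  Relation.ReflTransGen.trans hbc hab

theorem anc_iff_eq_or_anc_parent {w x : Fin G.n} (hx : x ≠ G.root) :
    G.Anc w x ↔ x = w ∨ G.Anc w (G.parent x) := by
  constructor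
  · intro h
    rcases Relation.ReflTransGen.cases_head h with rfl | ⟨_, ⟨_, rfl⟩, h⟩
    · exact .inl rfl
    · exact .inr h
  · rintro (rfl | h)
    · exact Relation.ReflTransGen.refl
    · exact Relation.ReflTransGen.head ⟨hx, rfl⟩ h

theorem not_anc_root {w : Fin G.n} (hw : w ≠ G.root) : ¬ G.Anc w G.root := fun h =>
  hw (le_antisymm h.le (G.root_le w))

theorem not_anc_parent {w : Fin G.n} (hw : w ≠ G.root) : ¬ G.Anc w (G.parent w) := fun h =>
  (G.parent_lt w hw).not_ge h.le

/-- The subtree of `w` is separated by a tree edge exactly when that edge is `(w, p(w))`. -/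
theorem anc_iff_anc_parent {w x : Fin G.n} (hw : w ≠ G.root) (hx : x ≠ G.root) :
    (G.Anc w x ↔ G.Anc w (G.parent x)) ↔ x ≠ w := by
  rw [anc_iff_eq_or_anc_parent hx]
  by_cases h : x = w
  · subst h
    simp [not_anc_parent hx]
  · simp [h]

/-- `B(w)` consists of the back-edges with exactly one end in the subtree of `w`. -/
theorem mem_B_iff {w : Fin G.n} {f : G.Edge} (hf : G.IsBack f) :
    f ∈ G.B w ↔ ¬ (G.Anc w (G.fst f) ↔ G.Anc w (G.snd f)) := by
  have hsf : G.Anc (G.snd f) (G.fst f) := G.back_anc f hf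
  constructor
  · rintro ⟨_, h1, h2, h3⟩ h
    exact h3 (le_antisymm h2.le (h.1 h1).le)
  · intro h
    have h1 : G.Anc w (G.fst f) := by
      by_contra h1
      exact h ⟨fun h' => (h1 h').elim, fun h' => h'.trans hsf⟩
    have h2 : ¬ G.Anc w (G.snd f) := fun h2 => h ⟨fun _ => h2, fun _ => h1⟩
    refine ⟨hf, h1, hsf.of_le h1 ?_, ?_⟩
    · by_contra hle
      exact h2 (h1.of_le hsf (not_le.1 hle).le)
    · intro heq
      exact h2 (heq ▸ Relation.ReflTransGen.refl)

/-- A vertex bipartition with both sides nonempty witnesses a cut. -/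
theorem isCut_of_bipartition {S : Set G.Edge} (C : Fin G.n → Prop) {x y : Fin G.n}
    (hx : C x) (hy : ¬ C y) (hS : ∀ f, f ∉ S → (C (G.fst f) ↔ C (G.snd f))) :
    G.IsCut S := by
  intro hconn
  refine hy ?_
  have h := hconn x y
  induction h with
  | refl => exact hx
  | tail _ hbc ih =>
    obtain ⟨f, hf, ⟨rfl, rfl⟩ | ⟨rfl, rfl⟩⟩ := hbc
    · exact (hS f hf).1 (by tauto)
    · exact (hS f hf).2 (by tauto)

/-- A minimal cut is exactly the set of edges crossing some vertex bipartition. -/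
theorem exists_bipartition_of_isCut {S : Set G.Edge} (hS : G.IsCut S)
    (hmin : ∀ f ∈ S, ¬ G.IsCut (S \ {f})) :
    ∃ C : Fin G.n → Prop, ∀ f, f ∈ S ↔ ¬ (C (G.fst f) ↔ C (G.snd f)) := by
  unfold IsCut ConnectedOff at hS
  push Not at hS
  obtain ⟨x, y, hxy⟩ := hS
  have hout : ∀ f, f ∉ S → (Relation.ReflTransGen (G.AdjOff S) x (G.fst f) ↔
      Relation.ReflTransGen (G.AdjOff S) x (G.snd f)) := fun f hf =>
    ⟨fun h => h.tail ⟨f, hf, .inl ⟨rfl, rfl⟩⟩, fun h => h.tail ⟨f, hf, .inr ⟨rfl, rfl⟩⟩⟩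
  refine ⟨fun z => Relation.ReflTransGen (G.AdjOff S) x z, fun f => ⟨fun hf hiff => ?_, ?_⟩⟩
  · refine hmin f hf (isCut_of_bipartition _ Relation.ReflTransGen.refl hxy fun g hg => ?_)
    by_cases hgf : g = f
    · exact hgf ▸ hiff
    · exact hout g fun hgS => hg ⟨hgS, hgf⟩
  · intro h
    by_contra hf
    exact h (hout f hf)

/-- If the tree edges crossing a bipartition are `(u, p(u))` and `(v, p(v))`, then the
bipartition is the symmetric difference of the subtrees of `u` and `v`. -/
theorem bipartition_iff {u v : Fin G.n} (hu : u ≠ G.root) (hv : v ≠ G.root) (huv : u ≠ v)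
    {C : Fin G.n → Prop}
    (hC : ∀ x, x ≠ G.root → ((C x ↔ C (G.parent x)) ↔ x ≠ u ∧ x ≠ v)) (x : Fin G.n) :
    (C x ↔ C G.root) ↔ (G.Anc u x ↔ G.Anc v x) := by
  induction x using WellFoundedLT.induction with
  | ind x ih =>
    by_cases hx : x = G.root
    · subst hx
      simp [not_anc_root hu, not_anc_root hv]
    · have h1 := ih _ (G.parent_lt x hx)
      have h2 := hC x hx
      have h3 := anc_iff_anc_parent hu hx
      have h4 := anc_iff_anc_parent hv hx
      have h5 : x = u → x ≠ v := fun h => h ▸ huv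
      grind

theorem EdgeConn.B_nonempty {k : ℕ} (hk : 2 ≤ k) (h : G.EdgeConn k) {w : Fin G.n}
    (hw : w ≠ G.root) : (G.B w).Nonempty := by
  by_contra hB
  refine h {G.tEdge w} (by rw [Set.ncard_singleton]; omega)
    (isCut_of_bipartition (G.Anc w) (x := w) Relation.ReflTransGen.refl (not_anc_root hw) ?_)
  intro f hf
  by_cases hft : G.IsTreeEdge f
  · obtain ⟨x, hx, rfl⟩ := hft
    rw [G.tEdge_fst x hx, G.tEdge_snd x hx, anc_iff_anc_parent hw hx]
    rintro rfl
    exact hf rfl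
  · by_contra hne
    exact hB ⟨f, (mem_B_iff hft).2 hne⟩

end DFSGraph

/-- Lemma 3.1, forward direction: Let `G` be `3`-edge-connected with DFS
tree `T` rooted at `r`, and let `u, v` be vertices distinct from `r` with `v < u`. If
`{(u,p(u)), (v,p(v)), e}` is a `3`-cut of `G`, where `e` is a back-edge, then `v` is an
ancestor of `u` and either `B(v) = B(u) ⊔ {e}` or `B(u) = B(v) ⊔ {e}` (disjoint union). -/
theorem stmt2 (G : DFSGraph) (h3 : G.EdgeConn 3) (u v : Fin G.n)
    (hu : u ≠ G.root) (hv : v ≠ G.root) (hvu : v < u)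
    (e : G.Edge) (he : G.IsBack e)
    (hcut : G.IsCut {G.tEdge u, G.tEdge v, e})
    (hcard : ({G.tEdge u, G.tEdge v, e} : Set G.Edge).ncard = 3) :
    G.Anc v u ∧
      ((G.B v = insert e (G.B u) ∧ e ∉ G.B u) ∨
       (G.B u = insert e (G.B v) ∧ e ∉ G.B v)) := by
  have hmin : ∀ f ∈ ({G.tEdge u, G.tEdge v, e} : Set G.Edge),
      ¬ G.IsCut ({G.tEdge u, G.tEdge v, e} \ {f}) := fun f hf =>
    h3 _ (hcard ▸ Set.ncard_sdiff_singleton_lt_of_mem hf (Set.toFinite _))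
  obtain ⟨C, hC⟩ := DFSGraph.exists_bipartition_of_isCut hcut hmin
  have htree : ∀ x, x ≠ G.root → ((C x ↔ C (G.parent x)) ↔ x ≠ u ∧ x ≠ v) := by
    intro x hx
    have h := hC (G.tEdge x)
    rw [G.tEdge_fst x hx, G.tEdge_snd x hx] at h
    have hxu : G.tEdge x = G.tEdge u ↔ x = u := ⟨G.tEdge_inj x u hx hu, fun h => h ▸ rfl⟩
    have hxv : G.tEdge x = G.tEdge v ↔ x = v := ⟨G.tEdge_inj x v hx hv, fun h => h ▸ rfl⟩
    have hxe : G.tEdge x ≠ e := fun h => he ⟨x, hx, h.symm⟩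
    simp only [Set.mem_insert_iff, Set.mem_singleton_iff, hxu, hxv, hxe, or_false] at h
    tauto
  have hcol := DFSGraph.bipartition_iff hu hv hvu.ne' htree
  have hback : ∀ f, G.IsBack f → (f = e ↔ ¬ (f ∈ G.B u ↔ f ∈ G.B v)) := by
    intro f hf
    have h := hC f
    have hfu : f ≠ G.tEdge u := fun h => hf ⟨u, hu, h⟩
    have hfv : f ≠ G.tEdge v := fun h => hf ⟨v, hv, h⟩
    simp only [Set.mem_insert_iff, Set.mem_singleton_iff, hfu, hfv, false_or] at h
    rw [h, DFSGraph.mem_B_iff hf, DFSGraph.mem_B_iff hf]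
    have h1 := hcol (G.fst f)
    have h2 := hcol (G.snd f)
    grind
  have hsymm : ∀ f, f ≠ e → (f ∈ G.B u ↔ f ∈ G.B v) := fun f hf =>
    ⟨fun h => by_contra fun h' => hf ((hback f h.1).2 fun hi => h' (hi.1 h)),
      fun h => by_contra fun h' => hf ((hback f h.1).2 fun hi => h' (hi.2 h))⟩
  have hee : ¬ (e ∈ G.B u ↔ e ∈ G.B v) := (hback e he).1 rfl
  constructor
  · obtain ⟨f, hf⟩ := h3.B_nonempty (by norm_num) hu
    obtain ⟨g, hg⟩ := h3.B_nonempty (by norm_num) hv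
    by_cases hfe : f = e
    · have hge : g ≠ e := by
        rintro rfl
        subst hfe
        exact hee ⟨fun _ => hg, fun _ => hf⟩
      exact hg.2.1.of_le ((hsymm g hge).2 hg).2.1 hvu.le
    · exact ((hsymm f hfe).1 hf).2.1.of_le hf.2.1 hvu.le
  · by_cases heu : e ∈ G.B u
    · have hev : e ∉ G.B v := fun h => hee ⟨fun _ => h, fun _ => heu⟩
      refine .inr ⟨Set.ext fun f => ?_, hev⟩
      by_cases hfe : f = e
      · simp [hfe, heu]
      · simp [hfe, hsymm f hfe]
    · have hev : e ∈ G.B v := by tauto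
      refine .inl ⟨Set.ext fun f => ?_, heu⟩
      by_cases hfe : f = e
      · simp [hfe, hev]
      · simp [hfe, hsymm f hfe]
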